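/- Let m ≥ 2. The only subspaces U ⊆ V satisfying U = ⊕_{r=1}^{m} (U ∩ V_r) and ρ(A)U ⊆ U for all A ∈ sl(m|1) are {0} and V itself; i.e., V is a simple graded sl(m|1)-module (it realizes the simple module with highest weight −ε_m + ε_{m+1}). -/

import Mathlib

open ExteriorAlgebra

open Matrix

variable (K : Type) [Field K]

/-- The space of matrices underlying `gl(m|n)`. -/
abbrev gl (m n : ℕ) : Type := Matrix (Fin (m + n)) (Fin (m + n)) K

/-- The parity of an index: indices `< m` are even, the rest odd. -/
def par (m n : ℕ) (i : Fin (m + n)) : ZMod 2 := if (i : ℕ) < m then 0 else 1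

/-- `A` is homogeneous of parity `p`. -/
def IsHom {m n : ℕ} (p : ZMod 2) (A : gl K m n) : Prop :=
  ∀ i j, A i j ≠ 0 → par m n i + par m n j = p

/-- The sign `(-1)^p` for `p : ZMod 2`. -/
def sg (p : ZMod 2) : K := if p = 0 then 1 else -1

/-- The even (block-diagonal) part of a matrix. -/
def evenP {m n : ℕ} (A : gl K m n) : gl K m n :=
  Matrix.of fun i j => if par m n i = par m n j then A i j else 0

/-- The odd (block-off-diagonal) part of a matrix. -/
def oddP {m n : ℕ} (A : gl K m n) : gl K m n :=
  Matrix.of fun i j => if par m n i = par m n j then 0 else A i j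

/-- The super bracket `⟨A,B⟩ = AB - (-1)^{|A||B|} BA` on homogeneous elements,
extended bilinearly to all of `gl(m|n)`. -/
def sbr {m n : ℕ} (A B : gl K m n) : gl K m n :=
  A * B - evenP K B * A - oddP K B * evenP K A + oddP K B * oddP K A

/-- The supertrace `Str(A) = Tr(a) - Tr(d)`. -/
def str {m n : ℕ} (A : gl K m n) : K := ∑ i, sg K (par m n i) * A i i

/-- `sl(m|n)`, the subspace of supertraceless matrices, as a submodule of `gl(m|n)`. -/
def sl (m n : ℕ) : Submodule K (gl K m n) where
  carrier := {A | str K A = 0}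
  add_mem' {A B} hA hB := by
    simp only [Set.mem_setOf_eq, str] at *
    simp [Matrix.add_apply, mul_add, Finset.sum_add_distrib, hA, hB]
  zero_mem' := by simp [str]
  smul_mem' c A hA := by
    simp only [Set.mem_setOf_eq, str] at *
    simp only [Matrix.smul_apply, smul_eq_mul, mul_left_comm, ← Finset.mul_sum, hA, mul_zero]

/-- The exterior algebra `Λ(E)` over `E = 𝕂^m`. -/
abbrev ExtAlg (m : ℕ) : Type := ExteriorAlgebra K (Fin m → K)

/-- The ambient space carrying `V = ⊕_{r=1}^m V_r`: an `m`-tuple of elements of `Λ(E)`,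
the component indexed by `r : Fin m` standing for the piece `V_{r+1} = ⋀^{m-1-r} E`. -/
abbrev Wam (m : ℕ) : Type := Fin m → ExtAlg K m

/-- Left exterior multiplication `ω ↦ v ∧ ω` by a vector `v ∈ E`. -/
def wmul {m : ℕ} (v : Fin m → K) : ExtAlg K m →ₗ[K] ExtAlg K m :=
  LinearMap.mulLeft K (ExteriorAlgebra.ι K v)

/-- Contraction (interior product) `ι_y` by a covector `y ∈ E*`. -/
def ctr {m : ℕ} (y : Module.Dual K (Fin m → K)) : ExtAlg K m →ₗ[K] ExtAlg K m :=
  CliffordAlgebra.contractLeft y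

/-- The derivation action `θ_a` of a matrix `a ∈ M_m(𝕂)` on the exterior algebra,
`θ_a (v₁ ∧ … ∧ v_k) = Σᵢ v₁ ∧ … ∧ (a vᵢ) ∧ … ∧ v_k`; concretely
`θ_a = Σ_{i,j} a_{ij} (e_i ∧ -) ∘ ι_{e_j*}`. -/
def theta {m : ℕ} (a : Matrix (Fin m) (Fin m) K) : ExtAlg K m →ₗ[K] ExtAlg K m :=
  ∑ i, ∑ j, a i j • (wmul K (Pi.single i 1) ∘ₗ ctr K (LinearMap.proj j))

/-- The upper-left `m×m` block `a` of `A ∈ gl(m|1)`. -/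
def blka {m : ℕ} (A : gl K m 1) : Matrix (Fin m) (Fin m) K :=
  Matrix.of fun i j => A (Fin.castSucc i) (Fin.castSucc j)

/-- The upper-right column `x` of `A ∈ gl(m|1)`. -/
def blkx {m : ℕ} (A : gl K m 1) : Fin m → K :=
  fun i => A (Fin.castSucc i) (Fin.last m)

/-- The lower-left row `y` of `A ∈ gl(m|1)`, as a covector. -/
def blky {m : ℕ} (A : gl K m 1) : Module.Dual K (Fin m → K) :=
  ∑ j, A (Fin.last m) (Fin.castSucc j) • (LinearMap.proj j :  (Fin m → K) →ₗ[K] K)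

/-- The lower-right entry `d` of `A ∈ gl(m|1)`. -/
def blkd {m : ℕ} (A : gl K m 1) : K := A (Fin.last m) (Fin.last m)

/-- Component `r` of the action `ρ(A)` on `V = ⊕_{r=1}^m V_r` (slot `r` standing for
`V_{r+1}`, `r = 0, …, m-1`): on `ω ∈ V_r` (paper numbering `r = 1, …, m`) it is
`θ_a ω - (Tr a) ω + r d ω` into `V_r`, plus `(r-1)(x ∧ ω)` into `V_{r-1}`, plus
`ι_y ω` into `V_{r+1}`. -/
def rhoComp {m : ℕ} (A : gl K m 1) (r : Fin m) : Wam K m →ₗ[K] ExtAlg K m :=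
  (theta K (blka K A) - (Matrix.trace (blka K A)) • LinearMap.id
      + ((((r : ℕ) + 1 : ℕ) : K) * blkd K A) • LinearMap.id) ∘ₗ LinearMap.proj r
    + (if h : (r : ℕ) + 1 < m then
        ((((r : ℕ) + 1 : ℕ) : K) • (wmul K (blkx K A) ∘ₗ LinearMap.proj (⟨(r : ℕ) + 1, h⟩ : Fin m)))
      else 0)
    + (if _h : 0 < (r : ℕ) then
        (ctr K (blky K A) ∘ₗ
          LinearMap.proj (⟨(r : ℕ) - 1, lt_of_le_of_lt (Nat.sub_le _ 1) r.isLt⟩ : Fin m))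
      else 0)

/-- The representation `ρ` of `gl(m|1)` on (the ambient space of) `V`. -/
def rho {m : ℕ} (A : gl K m 1) : Wam K m →ₗ[K] Wam K m :=
  LinearMap.pi (rhoComp K A)

/-- The submodule `V = ⊕_{r=1}^m V_r` with `V_r = ⋀^{m-r} E`. -/
def Vsub (m : ℕ) : Submodule K (Wam K m) :=
  Submodule.pi Set.univ fun r => ⋀[K]^(m - 1 - (r : ℕ)) (Fin m → K)

/-- The parity-`p` part of `V`: the sum of those `V_r` with `(m - r) % 2 = p`. -/
def Vpart (m : ℕ) (p : ZMod 2) : Submodule K (Wam K m) :=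
  Submodule.pi Set.univ fun r =>
    if ((m - 1 - (r : ℕ) : ℕ) : ZMod 2) = p then ⋀[K]^(m - 1 - (r : ℕ)) (Fin m → K) else ⊥

/-- The top wedge `e₁ ∧ e₂ ∧ … ∧ e_m ∈ ⋀^m E`. -/
def topWedge (m : ℕ) : ExtAlg K m :=
  (List.ofFn fun i : Fin m => ExteriorAlgebra.ι K (Pi.single i (1 : K))).prod

/-- `η_k = ι_{e_k*}(e₁ ∧ … ∧ e_m) ∈ ⋀^{m-1} E`. -/
def eta {m : ℕ} (k : Fin m) : ExtAlg K m :=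
  ctr K (LinearMap.proj k) (topWedge K m)
variable {K} in
/-- The odd element of `gl(m|1)` with upper-right column `x` and lower-left row `y`. -/
def oddBlock {m : ℕ} (x y : Fin m → K) : gl K m 1 :=
  Matrix.of (Fin.snoc (α := fun _ => Fin (m + 1) → K) (fun i => Fin.snoc (α := fun _ => K) 0 (x i))
    (Fin.snoc (α := fun _ => K) y 0))

section oddBlock

variable {K} {m : ℕ} (x y : Fin m → K)

lemma blka_oddBlock : blka K (oddBlock x y) = 0 := by
  ext i j
  simp [blka, oddBlock]

lemma blkx_oddBlock : blkx K (oddBlock x y) = x := by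
  ext i
  simp [blkx, oddBlock]

lemma blky_oddBlock : blky K (oddBlock x y) = ∑ j, y j • LinearMap.proj j := by
  simp [blky, oddBlock]

lemma blkd_oddBlock : blkd K (oddBlock x y) = 0 := by
  simp [blkd, oddBlock]

lemma oddBlock_mem_sl : oddBlock x y ∈ sl K m 1 := by
  refine Finset.sum_eq_zero fun i _ => ?_
  induction i using Fin.lastCases <;> simp [oddBlock]

lemma theta_zero : theta K (0 : Matrix (Fin m) (Fin m) K) = 0 := by
  simp [theta]

lemma rho_oddBlock_wedge (r : Fin m) (h : (r : ℕ) + 1 < m) (ω : ExtAlg K m) :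
    rho K (oddBlock x 0) (Pi.single ⟨r + 1, h⟩ ω) =
      Pi.single r ((((r : ℕ) + 1 : ℕ) : K) • (ExteriorAlgebra.ι K x * ω)) := by
  ext1 s
  have key : rhoComp K (oddBlock x 0) s (Pi.single ⟨r + 1, h⟩ ω) =
      if h : (s : ℕ) + 1 < m then (((s : ℕ) + 1 : ℕ) : K) • (ExteriorAlgebra.ι K x *
        (Pi.single ⟨r + 1, by assumption⟩ ω : Wam K m) ⟨s + 1, h⟩) else 0 := by
    simp only [rhoComp, blka_oddBlock, blkx_oddBlock, blky_oddBlock, blkd_oddBlock, theta_zero]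
    split_ifs <;> simp [ctr, wmul]
  rw [rho, LinearMap.pi_apply, key]
  rcases eq_or_ne s r with rfl | hs
  · simp [h]
  · have : ∀ hs', (⟨s + 1, hs'⟩ : Fin m) ≠ ⟨r + 1, h⟩ := fun hs' e =>
      hs (Fin.ext (by simpa using e))
    simp [hs, this]

lemma rho_oddBlock_contract (r : Fin m) (h : (r : ℕ) + 1 < m) (i : Fin m) (ω : ExtAlg K m) :
    rho K (oddBlock 0 (Pi.single i 1)) (Pi.single r ω) =
      Pi.single ⟨r + 1, h⟩ (ctr K (LinearMap.proj i) ω) := by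
  ext1 s
  have key : rhoComp K (oddBlock 0 (Pi.single i 1)) s (Pi.single r ω) =
      if 0 < (s : ℕ) then ctr K (LinearMap.proj i) ((Pi.single r ω : Wam K m)
        ⟨s - 1, lt_of_le_of_lt (Nat.sub_le _ 1) s.isLt⟩) else 0 := by
    simp only [rhoComp, blka_oddBlock, blkx_oddBlock, blky_oddBlock, blkd_oddBlock, theta_zero]
    split_ifs <;> simp [wmul, Pi.single_apply, ite_smul]
  rw [rho, LinearMap.pi_apply, key]
  rcases eq_or_ne s ⟨r + 1, h⟩ with rfl | hs
  · simp
  · rw [Pi.single_eq_of_ne hs]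
    split_ifs with h0
    · rw [Pi.single_eq_of_ne, map_zero]
      rintro rfl
      exact hs (Fin.ext (by simp; omega))
    · rfl

end oddBlock

variable {K} in
lemma mem_exteriorPower_zero {m : ℕ} {ω : ExtAlg K m} :
    ω ∈ ⋀[K]^0 (Fin m → K) ↔ ∃ c, algebraMap K (ExtAlg K m) c = ω := by
  rw [exteriorPower, pow_zero, Submodule.mem_one]

/-- Euler's identity: `∑ᵢ eᵢ ∧ ι_{eᵢ*} ω = k ω` for `ω ∈ ⋀^k E`. -/
lemma sum_wedge_contract {m : ℕ} (k : ℕ) :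
    ∀ ω ∈ ⋀[K]^k (Fin m → K), ∑ i, ExteriorAlgebra.ι K (Pi.single i (1 : K)) *
      ctr K (LinearMap.proj i) ω = (k : K) • ω := by
  induction k with
  | zero =>
    intro ω hω
    obtain ⟨c, rfl⟩ := mem_exteriorPower_zero.1 hω
    simp [ctr, CliffordAlgebra.contractLeft_algebraMap]
  | succ k ih =>
    intro ω hω
    rw [exteriorPower, pow_succ'] at hω
    induction hω using Submodule.mul_induction_on' with
    | mem_mul_mem a ha η hη =>
      obtain ⟨v, rfl⟩ := ha
      have hv : ∑ i, ExteriorAlgebra.ι K (Pi.single i (1 : K)) * (v i • η) =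
          ExteriorAlgebra.ι K v * η := by
        conv_rhs => rw [pi_eq_sum_univ' v, map_sum, Finset.sum_mul]
        simp
      have hc (i : Fin m) : ctr K (LinearMap.proj i) (ExteriorAlgebra.ι K v * η) =
          v i • η - ExteriorAlgebra.ι K v * ctr K (LinearMap.proj i) η :=
        CliffordAlgebra.contractLeft_ι_mul _ _ _
      have hs (i : Fin m) : ExteriorAlgebra.ι K (Pi.single i (1 : K)) *
          (ExteriorAlgebra.ι K v * ctr K (LinearMap.proj i) η) =
          -(ExteriorAlgebra.ι K v * (ExteriorAlgebra.ι K (Pi.single i (1 : K)) *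
            ctr K (LinearMap.proj i) η)) := by
        rw [← mul_assoc, ← mul_assoc, ← neg_mul,
          eq_neg_of_add_eq_zero_left (ExteriorAlgebra.ι_add_mul_swap _ _)]
      simp only [hc, mul_sub, hs, Finset.sum_sub_distrib, hv, Finset.sum_neg_distrib,
        ← Finset.mul_sum, ih η hη]
      rw [mul_smul_comm, Nat.cast_succ, add_smul, one_smul]
      abel
    | add a _ b _ ha hb =>
      simp only [map_add, mul_add, Finset.sum_add_distrib, ha, hb, smul_add]

/-- In positive degree, a form killed by all contractions vanishes. -/
lemma exists_contract_ne_zero [CharZero K] {m k : ℕ} {ω : ExtAlg K m}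
    (hω : ω ∈ ⋀[K]^(k + 1) (Fin m → K)) (h0 : ω ≠ 0) :
    ∃ i, ctr K (LinearMap.proj i) ω ≠ 0 := by
  by_contra! h
  have := sum_wedge_contract K (k + 1) ω hω
  simp only [h, mul_zero, Finset.sum_const_zero] at this
  exact (smul_ne_zero (Nat.cast_ne_zero.2 k.succ_ne_zero) h0) this.symm

section Invariant

variable {K} {m : ℕ} {U : Submodule K (Wam K m)}

/-- Contracting repeatedly reaches the vacuum vector `1 ∈ ⋀^0 E`. -/
lemma single_one_mem [CharZero K] (hUV : U ≤ Vsub K m)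
    (hinv : ∀ A ∈ sl K m 1, ∀ u ∈ U, rho K A u ∈ U) (k : ℕ) :
    ∀ r : Fin m, (r : ℕ) + k + 1 = m → ∀ ω ≠ 0, Pi.single r ω ∈ U →
      ∀ s : Fin m, (s : ℕ) + 1 = m → (Pi.single s 1 : Wam K m) ∈ U := by
  induction k with
  | zero =>
    intro r hr ω h0 hω s hs
    obtain rfl : s = r := Fin.ext (by omega)
    have hV := hUV hω s (Set.mem_univ _)
    simp only [Pi.single_eq_same, show m - 1 - (s : ℕ) = 0 by omega] at hV
    obtain ⟨c, rfl⟩ := mem_exteriorPower_zero.1 hV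
    have hc : c ≠ 0 := by
      rintro rfl
      simp at h0
    have := U.smul_mem c⁻¹ hω
    rwa [← Pi.single_smul, Algebra.algebraMap_eq_smul_one, inv_smul_smul₀ hc] at this
  | succ k ih =>
    intro r hr ω h0 hω
    have hV := hUV hω r (Set.mem_univ _)
    simp only [Pi.single_eq_same, show m - 1 - (r : ℕ) = k + 1 by omega] at hV
    obtain ⟨i, hi⟩ := exists_contract_ne_zero K hV h0
    have hr' : (r : ℕ) + 1 < m := by omega
    refine ih ⟨r + 1, hr'⟩ (by simp; omega) _ hi ?_
    rw [← rho_oddBlock_contract r hr']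
    exact hinv _ (oddBlock_mem_sl _ _) _ hω

/-- Wedging repeatedly with vectors reaches every piece of `V` from the vacuum vector. -/
lemma single_mem_of_single_one_mem [CharZero K]
    (hinv : ∀ A ∈ sl K m 1, ∀ u ∈ U, rho K A u ∈ U)
    (h1 : ∀ s : Fin m, (s : ℕ) + 1 = m → (Pi.single s 1 : Wam K m) ∈ U) (k : ℕ) :
    ∀ r : Fin m, (r : ℕ) + k + 1 = m → ∀ ω ∈ ⋀[K]^k (Fin m → K),
      (Pi.single r ω : Wam K m) ∈ U := by
  induction k with
  | zero =>
    intro r hr ω hω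
    obtain ⟨c, rfl⟩ := mem_exteriorPower_zero.1 hω
    rw [Algebra.algebraMap_eq_smul_one, Pi.single_smul]
    exact U.smul_mem c (h1 r (by omega))
  | succ k ih =>
    intro r hr ω hω
    rw [exteriorPower, pow_succ'] at hω
    induction hω using Submodule.mul_induction_on' with
    | mem_mul_mem a ha η hη =>
      obtain ⟨v, rfl⟩ := ha
      have hr' : (r : ℕ) + 1 < m := by omega
      have := hinv _ (oddBlock_mem_sl v 0) _ (ih ⟨r + 1, hr'⟩ (by simp; omega) η hη)
      rw [rho_oddBlock_wedge v r hr', Pi.single_smul] at this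
      exact (U.smul_mem_iff (Nat.cast_ne_zero.2 (Nat.succ_ne_zero _))).1 this
    | add a _ b _ ha hb =>
      rw [Pi.single_add]
      exact U.add_mem ha hb

end Invariant

/-- Let `m ≥ 2`.  The only subspaces `U ⊆ V` with `U = ⊕_r (U ∩ V_r)` and
`ρ(A)U ⊆ U` for all `A ∈ sl(m|1)` are `{0}` and `V` itself; i.e. `V` is a simple graded
`sl(m|1)`-module (it realizes the simple module with highest weight `-ε_m + ε_{m+1}`). -/
theorem V_is_simple_graded_module
    (K : Type) [Field K] [IsAlgClosed K] [CharZero K] (m : ℕ) (hm : 2 ≤ m)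
    (U : Submodule K (Wam K m))
    (hUV : U ≤ Vsub K m)
    (hgraded : ∀ u ∈ U, ∀ r : Fin m, Pi.single r (u r) ∈ U)
    (hinv : ∀ A ∈ sl K m 1, ∀ u ∈ U, rho K A u ∈ U) :
    U = ⊥ ∨ U = Vsub K m := by
  refine or_iff_not_imp_left.2 fun hU => le_antisymm hUV fun v hv => ?_
  obtain ⟨u, hu, hu0⟩ := U.exists_mem_ne_zero_of_ne_bot hU
  obtain ⟨r, hr⟩ := Function.ne_iff.1 hu0
  have h1 := single_one_mem hUV hinv (m - 1 - r) r (by omega) _ hr (hgraded u hu r)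
  rw [← Finset.univ_sum_single v]
  exact U.sum_mem fun s _ =>
    single_mem_of_single_one_mem hinv h1 _ s (by omega) _ (hv s (Set.mem_univ _))
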